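/- arXiv:1809.01126 — 2 statements merged into one kernel-verified Lean document; each statement's English description precedes it below -/
import Mathlib

section
/- Let R be a commutative ring, M an R-module, T the tensor algebra of M over R, and ι : M → T the canonical inclusion. Let b : M ⊗[R] T → T be the R-linear map determined by b(m ⊗ a) = (ι m) * a − a * (ι m). Then the R-submodule of T spanned by all commutators x * y − y * x (for x, y ∈ T) equals the range of b. -/
open TensorProduct

/-- A submodule of the tensor algebra containing every commutator with a generator contains every
commutator. -/
theorem commutator_mem_of_commutator_ι_mem
    {R : Type*} [CommRing R] {M : Type*} [AddCommGroup M] [Module R M]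
    (N : Submodule R (TensorAlgebra R M))
    (hN : ∀ (m : M) (a : TensorAlgebra R M),
      TensorAlgebra.ι R m * a - a * TensorAlgebra.ι R m ∈ N)
    (x y : TensorAlgebra R M) : x * y - y * x ∈ N := by
  induction x using TensorAlgebra.induction generalizing y with
  | algebraMap r => simp [Algebra.commutes r y]
  | ι m => exact hN m y
  | mul u v hu hv =>
    have h : u * v * y - y * (u * v) = (u * (v * y) - v * y * u) + (v * (y * u) - y * u * v) := by
      noncomm_ring
    rw [h]
    exact add_mem (hu _) (hv _)
  | add u v hu hv =>
    have h : (u + v) * y - y * (u + v) = (u * y - y * u) + (v * y - y * v) := by noncomm_ring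
    rw [h]
    exact add_mem (hu y) (hv y)

/-- For the tensor algebra `T = TensorAlgebra R M` over a commutative ring `R`, the
`R`-submodule of `T` spanned by all commutators `x * y − y * x` equals the range of the
`R`-linear map `b : M ⊗[R] T → T` determined by `b(m ⊗ a) = (ι m) * a − a * (ι m)`. -/
theorem commutator_span_eq_range_b
    (R : Type*) [CommRing R] (M : Type*) [AddCommGroup M] [Module R M]
    (b : M ⊗[R] TensorAlgebra R M →ₗ[R] TensorAlgebra R M)
    (hb : ∀ (m : M) (a : TensorAlgebra R M),
        b (m ⊗ₜ[R] a) = TensorAlgebra.ι R m * a - a * TensorAlgebra.ι R m) :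
    Submodule.span R {z : TensorAlgebra R M | ∃ x y : TensorAlgebra R M, z = x * y - y * x} =
      LinearMap.range b := by
  apply le_antisymm
  · rw [Submodule.span_le]
    rintro _ ⟨x, y, rfl⟩
    exact commutator_mem_of_commutator_ι_mem (LinearMap.range b) (fun m a => ⟨m ⊗ₜ a, hb m a⟩) x y
  · rintro _ ⟨t, rfl⟩
    induction t using TensorProduct.induction_on with
    | zero => simp
    | tmul m a => exact Submodule.subset_span ⟨_, a, hb m a⟩
    | add s t hs ht => rw [map_add]; exact add_mem hs ht
end

section
/- Let k be a commutative ring, ι a finite type, and S = (ι → k) the product k-algebra with componentwise operations. Let Q be an S-module which is also a k-module via the algebra map k → S (i.e. the k-action and S-action are compatible in the sense of IsScalarTower k S Q). If Q is projective as a k-module, then Q is projective as an S-module. -/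
/-- Averaging a `k`-linear map between `(ι → k)`-modules over the coordinate idempotents:
`x ↦ ∑ i, eᵢ • h (eᵢ • x)` is linear over `ι → k`. -/
def LinearMap.piAverage {k ι M N : Type*} [CommSemiring k] [Fintype ι] [DecidableEq ι]
    [AddCommMonoid M] [Module k M] [Module (ι → k) M] [IsScalarTower k (ι → k) M]
    [AddCommMonoid N] [Module k N] [Module (ι → k) N] [IsScalarTower k (ι → k) N]
    (h : M →ₗ[k] N) : M →ₗ[ι → k] N where
  toFun x := ∑ i, (Pi.single i 1 : ι → k) • h ((Pi.single i 1 : ι → k) • x)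
  map_add' x y := by simp only [smul_add, map_add, Finset.sum_add_distrib]
  map_smul' s x := by
    rw [RingHom.id_apply, Finset.smul_sum]
    refine Finset.sum_congr rfl fun i _ => ?_
    have hl : (Pi.single i 1 : ι → k) * s = s i • (Pi.single i 1 : ι → k) := by
      ext j
      obtain rfl | hj := eq_or_ne j i <;> simp [*]
    rw [← mul_smul, hl, smul_assoc, map_smul, ← mul_smul s, mul_comm s, hl, smul_assoc,
      ← algebraMap_smul (ι → k) (s i), ← algebraMap_smul (ι → k) (s i), smul_comm]

theorem LinearMap.comp_piAverage {k ι M N : Type*} [CommSemiring k] [Fintype ι] [DecidableEq ι]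
    [AddCommMonoid M] [Module k M] [Module (ι → k) M] [IsScalarTower k (ι → k) M]
    [AddCommMonoid N] [Module k N] [Module (ι → k) N] [IsScalarTower k (ι → k) N]
    (f : N →ₗ[ι → k] M) (h : M →ₗ[k] N) (hfh : ∀ x, f (h x) = x) :
    f ∘ₗ h.piAverage = LinearMap.id := by
  ext x
  have hi (i : ι) : (Pi.single i 1 : ι → k) * Pi.single i 1 = Pi.single i 1 := by
    rw [← Pi.single_mul, one_mul]
  have hs : ∑ i, (Pi.single i 1 : ι → k) = 1 := Finset.univ_sum_single (1 : ι → k)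
  simp only [LinearMap.comp_apply, piAverage, LinearMap.coe_mk, AddHom.coe_mk, map_sum, map_smul,
    hfh, ← mul_smul, hi, ← Finset.sum_smul, hs, one_smul, LinearMap.id_apply]


/-- Let `k` be a commutative ring, `ι` a finite type and `S = ι → k` the product `k`-algebra
with componentwise operations. If `Q` is an `S`-module whose underlying `k`-module structure
(obtained via the algebra map `k → S`, i.e. `IsScalarTower k S Q`) is projective, then `Q` is
projective as an `S`-module. -/
theorem projective_over_pi_of_projective_over_base
    (k : Type*) [CommRing k] (ι : Type*) [Finite ι]
    (Q : Type*) [AddCommGroup Q] [Module k Q] [Module (ι → k) Q]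
    [IsScalarTower k (ι → k) Q]
    (hQ : Module.Projective k Q) :
    Module.Projective (ι → k) Q := by
  classical
  have := Fintype.ofFinite ι
  refine Module.Projective.of_lifting_property'' fun f hf => ?_
  obtain ⟨h, hh⟩ := Module.projective_lifting_property (f.restrictScalars k) LinearMap.id hf
  exact ⟨h.piAverage, f.comp_piAverage h (LinearMap.congr_fun hh)⟩
end
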